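/- Extensions coincide with truth sets in the canonical model: for every sentence B, Ext(B) = { m/h : m/h a moment-history pair of the canonical model M with M, m/h ⊨ B }. -/

import Mathlib

set_option maxHeartbeats 1000000

/-! Syntax: countably many variables (indexed by ℕ), Booleans (⊥, →),
    modalities `S` (box), `[c]_a` (cstit) and `I_a` (imag) for agents in `Agent`. -/

inductive Form (Agent : Type) : Type
  | var : ℕ → Form Agent
  | fls : Form Agent
  | imp : Form Agent → Form Agent → Form Agent
  | box : Form Agent → Form Agent
  | cstit : Agent → Form Agent → Form Agent
  | imag : Agent → Form Agent → Form Agent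

namespace Form

variable {Agent : Type}

def neg (A : Form Agent) : Form Agent := A.imp .fls

def conj (A B : Form Agent) : Form Agent := (A.imp B.neg).neg

def fiff (A B : Form Agent) : Form Agent := (A.imp B).conj (B.imp A)

/-- `P`, the dual of `S`. -/
def pos (A : Form Agent) : Form Agent := A.neg.box.neg

/-- The dual of `[c]_a`. -/
def posC (a : Agent) (A : Form Agent) : Form Agent := (Form.cstit a A.neg).neg

def verum : Form Agent := (Form.fls : Form Agent).neg

end Form

def listConj {Agent : Type} : List (Form Agent) → Form Agent
  | [] => Form.verum
  | A :: l => A.conj (listConj l)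

/-- Propositional tautologies: true under every Boolean valuation treating
    variables and modalized formulas as atoms. -/
def Tautology {Agent : Type} (A : Form Agent) : Prop :=
  ∀ v : Form Agent → Prop, ¬ v .fls → (∀ B C : Form Agent, v (B.imp C) ↔ (v B → v C)) → v A

/-- The Hilbert system L: (A0) tautologies, (A1) S is S5, (A2) each [c]_a is S5,
    (A3) SA → [c]_aA, (A4) independence axiom, (A5) imagination-as-action axiom;
    rules: modus ponens, S-necessitation, replacement of equivalents under I_a. -/
inductive Prov {Agent : Type} : Form Agent → Prop
  | taut {A : Form Agent} : Tautology A → Prov A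
  | sK (A B : Form Agent) : Prov ((A.imp B).box.imp (A.box.imp B.box))
  | sT (A : Form Agent) : Prov (A.box.imp A)
  | s5 (A : Form Agent) : Prov (A.pos.imp A.pos.box)
  | cK (a : Agent) (A B : Form Agent) :
      Prov ((Form.cstit a (A.imp B)).imp ((Form.cstit a A).imp (Form.cstit a B)))
  | cT (a : Agent) (A : Form Agent) : Prov ((Form.cstit a A).imp A)
  | c5 (a : Agent) (A : Form Agent) :
      Prov ((Form.posC a A).imp (Form.cstit a (Form.posC a A)))
  | a3 (a : Agent) (A : Form Agent) : Prov (A.box.imp (Form.cstit a A))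
  | a4 (l : List (Agent × Form Agent)) (hne : l ≠ []) (hnd : (l.map Prod.fst).Nodup) :
      Prov ((listConj (l.map fun p => (Form.cstit p.1 p.2).pos)).imp
        (listConj (l.map fun p => Form.cstit p.1 p.2)).pos)
  | a5 (a : Agent) (A : Form Agent) :
      Prov ((Form.imag a A).imp ((Form.cstit a (Form.imag a A)).conj (Form.imag a A).box.neg))
  | mp {A B : Form Agent} : Prov (A.imp B) → Prov A → Prov B
  | necS {A : Form Agent} : Prov A → Prov A.box
  | reI (a : Agent) {A B : Form Agent} :
      Prov (A.fiff B) → Prov ((Form.imag a A).fiff (Form.imag a B))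

/-- A set is L-consistent iff no finite conjunction of its members derives a contradiction. -/
def Consistent {Agent : Type} (Γ : Set (Form Agent)) : Prop :=
  ¬ ∃ l : List (Form Agent), (∀ A ∈ l, A ∈ Γ) ∧ Prov ((listConj l).imp .fls)

/-- L-maxiconsistent: L-consistent and maximal among L-consistent sets. -/
def MaxConsistent {Agent : Type} (w : Set (Form Agent)) : Prop :=
  Consistent w ∧ ∀ Γ : Set (Form Agent), Consistent Γ → w ⊆ Γ → Γ = w

/-- Σ = {¬p : p ∈ Var} ∪ {SA ↔ A} ∪ {[c]_aA ↔ A}. -/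
def SigmaSet (Agent : Type) : Set (Form Agent) :=
  {φ | (∃ n : ℕ, φ = (Form.var n : Form Agent).neg) ∨
       (∃ A : Form Agent, φ = A.box.fiff A) ∨
       (∃ (a : Agent) (A : Form Agent), φ = (Form.cstit a A).fiff A)}

/-! Semantics: imagination models and satisfaction. -/

/-- The raw data of an imagination model (frame conditions separated out below). -/
structure PreModel (Agent : Type) where
  Tree : Type
  le : Tree → Tree → Prop
  Choice : Tree → Agent → Set (Set (Set Tree))
  N : Agent → Tree → Set Tree → Set (Set (Tree × Set Tree))
  V : ℕ → Set (Tree × Set Tree)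

namespace PreModel

variable {Agent : Type} (M : PreModel Agent)

/-- Histories are maximal chains. -/
def IsHist (h : Set M.Tree) : Prop := IsMaxChain M.le h

/-- The set of histories passing through `m`. -/
def Hm (m : M.Tree) : Set (Set M.Tree) := {h | M.IsHist h ∧ m ∈ h}

/-- `Choice^m_a(h)`: the histories lying in the same choice cell as `h` at `m`. -/
def Cell (m : M.Tree) (a : Agent) (h : Set M.Tree) : Set (Set M.Tree) :=
  {h' | ∃ e ∈ M.Choice m a, h ∈ e ∧ h' ∈ e}

/-- Satisfaction at a moment-history pair. -/
def Sat : Form Agent → M.Tree → Set M.Tree → Prop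
  | .var n, m, h => (m, h) ∈ M.V n
  | .fls, _, _ => False
  | .imp A B, m, h => Sat A m h → Sat B m h
  | .box A, m, h => ∀ h' ∈ M.Hm m, Sat A m h'
  | .cstit a A, m, h => ∀ h' ∈ M.Cell m a h, Sat A m h'
  | .imag a A, m, h =>
      (∀ h' ∈ M.Cell m a h,
        {p : M.Tree × Set M.Tree | M.IsHist p.2 ∧ p.1 ∈ p.2 ∧ Sat A p.1 p.2} ∈ M.N a m h') ∧
      (∃ h'' ∈ M.Hm m,
        {p : M.Tree × Set M.Tree | M.IsHist p.2 ∧ p.1 ∈ p.2 ∧ Sat A p.1 p.2} ∉ M.N a m h'')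

end PreModel

/-- An imagination model: the raw data together with all frame conditions. -/
structure IModel (Agent : Type) extends PreModel Agent where
  tree_nonempty : Nonempty Tree
  le_refl : ∀ x, le x x
  le_antisymm : ∀ x y, le x y → le y x → x = y
  le_trans : ∀ x y z, le x y → le y z → le x z
  lower_bound : ∀ m1 m2, ∃ m, le m m1 ∧ le m m2
  past_linear : ∀ m m1 m2, le m1 m → le m2 m → le m1 m2 ∨ le m2 m1
  choice_cells_nonempty : ∀ m a, ∀ e ∈ Choice m a, e.Nonempty
  choice_cover : ∀ m a, ⋃₀ (Choice m a) = toPreModel.Hm m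
  choice_disjoint : ∀ m a, ∀ e ∈ Choice m a, ∀ e' ∈ Choice m a, e ≠ e' → e ∩ e' = ∅
  no_choice_between_undivided : ∀ m a, ∀ e ∈ Choice m a, ∀ h h',
      h ∈ toPreModel.Hm m → h' ∈ toPreModel.Hm m → h ∈ e →
      (∃ m', (le m m' ∧ m ≠ m') ∧ m' ∈ h ∧ m' ∈ h') → h' ∈ e
  independence : ∀ m (f : Agent → Set (Set Tree)), (∀ a, f a ∈ Choice m a) →
      (⋂ a, f a).Nonempty

/-! The canonical model. -/

section Canonical

variable {Agent : Type}

/-- wRw' iff {A : SA ∈ w} ⊆ w'. -/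
def CanR (w w' : Set (Form Agent)) : Prop := ∀ A : Form Agent, A.box ∈ w → A ∈ w'

/-- w ≃_a w' iff {A : [c]_aA ∈ w} ⊆ w'. -/
def CanC (a : Agent) (w w' : Set (Form Agent)) : Prop :=
  ∀ A : Form Agent, Form.cstit a A ∈ w → A ∈ w'

/-- The R-class of a maxiconsistent set. -/
def RCls (w : Set (Form Agent)) : Set (Set (Form Agent)) :=
  {w' | MaxConsistent w' ∧ CanR w w'}

/-- Ξ: the set of R-equivalence classes. -/
def Xi (Agent : Type) : Set (Set (Set (Form Agent))) :=
  {X | ∃ w, MaxConsistent w ∧ X = RCls w}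

/-- E(X,a): the ≃_a-equivalence classes within X. -/
def ECls (X : Set (Set (Form Agent))) (a : Agent) : Set (Set (Set (Form Agent))) :=
  {e | ∃ w ∈ X, e = {w' ∈ X | CanC a w w'}}

/-- Raw canonical points: the fresh root `none`, classes `some (inl X)`, worlds `some (inr w)`. -/
def CPoint (Agent : Type) : Type := Option (Set (Set (Form Agent)) ⊕ Set (Form Agent))

/-- Tree = {0} ∪ Ξ ∪ W. -/
def CTreeSet (Agent : Type) : Set (CPoint Agent) :=
  {x | x = none ∨ (∃ X ∈ Xi Agent, x = some (Sum.inl X)) ∨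
       (∃ w, MaxConsistent w ∧ x = some (Sum.inr w))}

def CTree (Agent : Type) : Type := {x : CPoint Agent // x ∈ CTreeSet Agent}

/-- x ≤ y iff x = y or y ∈ x or x = 0. -/
def CLe (x y : CTree Agent) : Prop :=
  x = y ∨ (∃ X w, x.1 = some (Sum.inl X) ∧ y.1 = some (Sum.inr w) ∧ w ∈ X) ∨ x.1 = none

/-- h_w = {0, X, w}. -/
def CHistX (X : Set (Set (Form Agent))) (w : Set (Form Agent)) : Set (CTree Agent) :=
  {x | x.1 = none ∨ x.1 = some (Sum.inl X) ∨ x.1 = some (Sum.inr w)}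

def IsClsMoment (m : CTree Agent) : Prop := ∃ X, m.1 = some (Sum.inl X)

/-- The canonical choice function: vacuous outside Ξ, induced by E(X,a) at X ∈ Ξ. -/
def CChoice (m : CTree Agent) (a : Agent) : Set (Set (Set (CTree Agent))) :=
  {H | (¬ IsClsMoment m ∧ H = {h | IsMaxChain CLe h ∧ m ∈ h}) ∨
       (∃ X, m.1 = some (Sum.inl X) ∧ ∃ e ∈ ECls X a,
          H = {h | ∃ w ∈ e, h = CHistX X w})}

/-- Ext(A): {X/h_w : w ∈ X ∈ Ξ, A ∈ w}, augmented by all pairs m/h_w with m ∉ Ξ, m ∈ h_w,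
    in case A belongs to the maxiconsistent extension of Σ. -/
def CExt (A : Form Agent) : Set (CTree Agent × Set (CTree Agent)) :=
  {p | ∃ X w, X ∈ Xi Agent ∧ w ∈ X ∧ A ∈ w ∧
        p.1.1 = some (Sum.inl X) ∧ p.2 = CHistX X w} ∪
  {p | (∃ w0, MaxConsistent w0 ∧ SigmaSet Agent ⊆ w0 ∧ A ∈ w0) ∧
        ∃ X w, X ∈ Xi Agent ∧ w ∈ X ∧ p.2 = CHistX X w ∧
          ¬ IsClsMoment p.1 ∧ p.1 ∈ p.2}

/-- N_a(X/h_w) = {Ext A : I_aA ∈ w}; empty at moments outside Ξ. -/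
def CN (a : Agent) (m : CTree Agent) (h : Set (CTree Agent)) :
    Set (Set (CTree Agent × Set (CTree Agent))) :=
  {P | ∃ X w, m.1 = some (Sum.inl X) ∧ X ∈ Xi Agent ∧ w ∈ X ∧ h = CHistX X w ∧
        ∃ A, Form.imag a A ∈ w ∧ P = CExt A}

/-- V(p) = {X/h_w : w ∈ X ∈ Ξ, p ∈ w}. -/
def CV (Agent : Type) (n : ℕ) : Set (CTree Agent × Set (CTree Agent)) :=
  {p | ∃ X w, X ∈ Xi Agent ∧ w ∈ X ∧ Form.var n ∈ w ∧
        p.1.1 = some (Sum.inl X) ∧ p.2 = CHistX X w}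

/-- The canonical model (raw data). -/
def CanModel (Agent : Type) : PreModel Agent where
  Tree := CTree Agent
  le := CLe
  Choice := CChoice
  N := CN
  V := CV Agent

/-- The canonical moment corresponding to a class X ∈ Ξ. -/
def clsMoment {X : Set (Set (Form Agent))} (hX : X ∈ Xi Agent) : CTree Agent :=
  ⟨some (Sum.inl X), Or.inr (Or.inl ⟨X, hX, rfl⟩)⟩

end Canonical

section Helpers

variable {Agent : Type}

structure IsVal (v : Form Agent → Prop) : Prop where
  fls : ¬ v .fls
  imp : ∀ B C : Form Agent, v (B.imp C) ↔ (v B → v C)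

namespace IsVal
variable {v : Form Agent → Prop} (hv : IsVal v)
theorem neg (hv : IsVal v) (A : Form Agent) : v A.neg ↔ ¬ v A := by
  have := hv.fls
  simp [Form.neg, hv.imp, this]
theorem conj (hv : IsVal v) (A B : Form Agent) : v (A.conj B) ↔ (v A ∧ v B) := by
  simp [Form.conj, hv.imp, hv.neg]
theorem fiff (hv : IsVal v) (A B : Form Agent) : v (A.fiff B) ↔ (v A ↔ v B) := by
  simp only [Form.fiff, hv.imp, hv.conj]; tauto
theorem lc (hv : IsVal v) (l : List (Form Agent)) : v (listConj l) ↔ ∀ A ∈ l, v A := by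
  induction l with
  | nil => simp [listConj, Form.verum, hv.neg, hv.fls]
  | cons A l ih => simp [listConj, hv.conj, ih]
end IsVal

theorem prov0 {A : Form Agent} (h : ∀ v, IsVal v → v A) : Prov A :=
  Prov.taut fun v h1 h2 => h v ⟨h1, h2⟩

theorem prov1 {A B : Form Agent} (hB : Prov B) (h : ∀ v, IsVal v → v B → v A) : Prov A :=
  Prov.mp (prov0 fun v hv => (hv.imp _ _).2 (h v hv)) hB

theorem prov2 {A B C : Form Agent} (hB : Prov B) (hC : Prov C)
    (h : ∀ v, IsVal v → v B → v C → v A) : Prov A :=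
  Prov.mp (prov1 hB fun v hv b => (hv.imp C A).2 (h v hv b)) hC

/-- the collapsed valuation -/
def cv : Form Agent → Prop
  | .var _ => False
  | .fls => False
  | .imp A B => cv A → cv B
  | .box A => cv A
  | .cstit _ A => cv A
  | .imag _ _ => False

theorem cv_val : IsVal (cv : Form Agent → Prop) := ⟨by simp [cv], by simp [cv]⟩

theorem cv_sound {A : Form Agent} (h : Prov A) : cv A := by
  induction h with
  | taut h => exact h _ cv_val.fls cv_val.imp
  | a4 l hne hnd =>
    simp only [cv_val.imp, cv_val.lc, Form.pos, cv_val.neg, cv, List.mem_map]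
    intro h
    simp only [not_not]
    rintro _ ⟨p, hp, rfl⟩
    have := h _ ⟨p, hp, rfl⟩
    simpa [cv_val.neg, cv] using this
  | a5 a A => simp [cv]
  | mp _ _ h1 h2 => exact h1 h2
  | reI a _ _ => simp [cv_val.fiff, cv]
  | _ => simp_all [cv, Form.pos, Form.posC, cv_val.neg]

/-- canonical Sigma world -/
def cw (Agent : Type) : Set (Form Agent) := {A | cv A}

theorem cw_max : MaxConsistent (cw Agent) := by
  constructor
  · rintro ⟨l, hl, hp⟩
    exact (cv_val.imp _ _).1 (cv_sound hp) ((cv_val.lc l).2 hl)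
  · intro Γ hΓ hsub
    refine Set.Subset.antisymm ?_ hsub
    intro A hA
    by_contra hn
    have h1 : A.neg ∈ Γ := hsub ((cv_val.neg A).2 hn)
    refine hΓ ⟨[A, A.neg], by simp [hA, h1], prov0 fun v hv => ?_⟩
    simp [hv.imp, hv.lc, hv.neg, hv.fls]

theorem cw_sigma : SigmaSet Agent ⊆ cw Agent := by
  rintro φ (⟨n, rfl⟩ | ⟨A, rfl⟩ | ⟨a, A, rfl⟩) <;> simp [cw, cv_val.neg, cv_val.fiff, cv]

theorem incons_insert {Γ : Set (Form Agent)} {A : Form Agent} (h : ¬ Consistent (insert A Γ)) :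
    ∃ l : List (Form Agent), (∀ B ∈ l, B ∈ Γ) ∧ Prov ((listConj l).imp A.neg) := by
  classical
  simp only [Consistent, not_not] at h
  obtain ⟨l, hl, hp⟩ := h
  refine ⟨l.filter (fun B => B ≠ A), ?_, prov1 hp fun v hv h => ?_⟩
  · intro B hB
    simp at hB
    rcases hl B hB.1 with h | h
    · exact absurd h hB.2
    · exact h
  · rw [hv.imp, hv.lc] at h ⊢
    intro h1
    rw [hv.neg]
    intro h2
    refine hv.fls (h fun B hB => ?_)
    by_cases e : B = A
    · exact e ▸ h2
    · exact h1 B (by simp [hB, e])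

namespace MaxConsistent
variable {w : Set (Form Agent)}

theorem closed (hw : MaxConsistent w) {l : List (Form Agent)} {A : Form Agent}
    (hl : ∀ B ∈ l, B ∈ w) (hp : Prov ((listConj l).imp A)) : A ∈ w := by
  have hc : Consistent (insert A w) := by
    by_contra h
    obtain ⟨l', hl', hp'⟩ := incons_insert h
    refine hw.1 ⟨l ++ l', ?_, prov2 hp hp' fun v hv h1 h2 => ?_⟩
    · intro B hB
      rcases List.mem_append.1 hB with h | h
      · exact hl B h
      · exact hl' B h
    · rw [hv.imp, hv.lc] at *
      intro h3
      rw [hv.neg] at h2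
      exact absurd (h1 fun B hB => h3 B (by simp [hB])) (h2 fun B hB => h3 B (by simp [hB]))
  have := hw.2 _ hc (Set.subset_insert _ _)
  rw [← this]; exact Set.mem_insert _ _

theorem not_mem (hw : MaxConsistent w) {A : Form Agent} (h : A ∉ w) : A.neg ∈ w := by
  have hc : ¬ Consistent (insert A w) := by
    intro hc
    have := hw.2 _ hc (Set.subset_insert _ _)
    exact h (this ▸ Set.mem_insert _ _)
  obtain ⟨l, hl, hp⟩ := incons_insert hc
  exact hw.closed hl hp

theorem fls_not (hw : MaxConsistent w) : Form.fls ∉ w := fun h =>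
  hw.1 ⟨[.fls], by simpa using h, prov0 fun v hv => by simp [hv.imp, hv.lc]⟩

theorem ofProv (hw : MaxConsistent w) {A : Form Agent} (h : Prov A) : A ∈ w :=
  hw.closed (l := []) (by simp) (prov1 h fun v hv h => (hv.imp _ _).2 fun _ => h)

theorem isVal (hw : MaxConsistent w) : IsVal (fun A => A ∈ w) := by
  refine ⟨hw.fls_not, fun B C => ⟨fun h1 h2 => ?_, fun h => ?_⟩⟩
  · exact hw.closed (l := [B.imp C, B]) (by simp [h1, h2]) (prov0 fun v hv => by
      simp only [hv.imp, hv.lc, List.mem_cons, List.not_mem_nil]; simp [hv.imp])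
  · by_cases hB : B ∈ w
    · exact hw.closed (l := [C]) (by simp [h hB]) (prov0 fun v hv => by
        simp only [hv.imp, hv.lc]; simp; tauto)
    · exact hw.closed (l := [B.neg]) (by simp [hw.not_mem hB]) (prov0 fun v hv => by
        simp only [hv.imp, hv.lc]; simp [hv.neg]; tauto)

theorem mp (hw : MaxConsistent w) {A B : Form Agent} (h : Prov (A.imp B)) (hA : A ∈ w) : B ∈ w :=
  (hw.isVal.imp A B).1 (hw.ofProv h) hA

theorem mem_neg (hw : MaxConsistent w) (A : Form Agent) : A.neg ∈ w ↔ A ∉ w := hw.isVal.neg A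

end MaxConsistent

theorem eq_cw {w : Set (Form Agent)} (hw : MaxConsistent w) (hs : SigmaSet Agent ⊆ w)
    (A : Form Agent) : A ∈ w ↔ cv A := by
  have hb : ∀ A : Form Agent, A.box ∈ w ↔ A ∈ w := fun A =>
    (hw.isVal.fiff _ _).1 (hs (Or.inr (Or.inl ⟨A, rfl⟩)))
  have hc : ∀ a (A : Form Agent), Form.cstit a A ∈ w ↔ A ∈ w := fun a A =>
    (hw.isVal.fiff _ _).1 (hs (Or.inr (Or.inr ⟨a, A, rfl⟩)))
  induction A with
  | var n => simpa [cv] using (hw.mem_neg _).1 (hs (Or.inl ⟨n, rfl⟩))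
  | fls => simpa [cv] using hw.fls_not
  | imp A B ihA ihB => exact (hw.isVal.imp A B).trans (imp_congr ihA ihB)
  | box A ih => exact (hb A).trans ih
  | cstit a A ih => exact (hc a A).trans ih
  | imag a A _ =>
    simp only [cv, iff_false]
    intro h
    have h1 := hw.mp (Prov.a5 a A) h
    have h2 := ((hw.isVal.conj _ _).1 h1).2
    exact (hw.mem_neg _).1 h2 ((hb _).2 h)

theorem lindenbaum {Γ : Set (Form Agent)} (h : Consistent Γ) : ∃ w, MaxConsistent w ∧ Γ ⊆ w := by
  obtain ⟨w, hsub, hm⟩ := zorn_subset_nonempty {Γ : Set (Form Agent) | Consistent Γ} (by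
    intro c hc hch hne
    refine ⟨⋃₀ c, ?_, fun s hs => Set.subset_sUnion_of_mem hs⟩
    rintro ⟨l, hl, hp⟩
    have : ∃ s ∈ c, ∀ A ∈ l, A ∈ s := by
      clear hp
      induction l with
      | nil => obtain ⟨s, hs⟩ := hne; exact ⟨s, hs, by simp⟩
      | cons A l ih =>
        obtain ⟨s, hs, h1⟩ := ih fun B hB => hl B (by simp [hB])
        obtain ⟨t, ht, h2⟩ := hl A (by simp)
        rcases hch.total hs ht with h | h
        · refine ⟨t, ht, fun B hB => ?_⟩
          rcases List.mem_cons.1 hB with rfl | hB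
          · exact h2
          · exact h (h1 B hB)
        · refine ⟨s, hs, fun B hB => ?_⟩
          rcases List.mem_cons.1 hB with rfl | hB
          · exact h h2
          · exact h1 B hB
    obtain ⟨s, hs, h1⟩ := this
    exact hc hs ⟨l, h1, hp⟩) Γ h
  exact ⟨w, ⟨hm.prop, fun Δ hΔ hs => (hm.eq_of_subset hΔ hs).symm⟩, hsub⟩

theorem prov_of_all {A : Form Agent} (h : ∀ w, MaxConsistent w → A ∈ w) : Prov A := by
  by_contra hn
  have hc : Consistent (insert A.neg (∅ : Set (Form Agent))) := by
    by_contra hc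
    obtain ⟨l, hl, hp⟩ := incons_insert hc
    refine hn (prov1 hp fun v hv h => ?_)
    rw [hv.imp, hv.lc, hv.neg, hv.neg, not_not] at h
    exact h fun B hB => absurd (hl B hB) (by simp)
  obtain ⟨w, hw, hs⟩ := lindenbaum hc
  exact (hw.mem_neg _).1 (hs (Set.mem_insert _ _)) (h w hw)

structure S5op (f : Form Agent → Form Agent) : Prop where
  K : ∀ A B, Prov ((f (A.imp B)).imp ((f A).imp (f B)))
  T : ∀ A, Prov ((f A).imp A)
  five : ∀ A : Form Agent, Prov ((f A.neg).neg.imp (f (f A.neg).neg))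
  nec : ∀ A, Prov A → Prov (f A)

def opRel (f : Form Agent → Form Agent) (w w' : Set (Form Agent)) : Prop := ∀ A, f A ∈ w → A ∈ w'

theorem s5_box : S5op (Form.box : Form Agent → Form Agent) :=
  ⟨Prov.sK, Prov.sT, Prov.s5, fun _ => Prov.necS⟩

theorem s5_c (a : Agent) : S5op (Form.cstit a : Form Agent → Form Agent) :=
  ⟨Prov.cK a, Prov.cT a, Prov.c5 a, fun A h => Prov.mp (Prov.a3 a A) (Prov.necS h)⟩

namespace S5op
variable {f : Form Agent → Form Agent} {w w1 w2 : Set (Form Agent)}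

theorem mono (hf : S5op f) (hw : MaxConsistent w) {A B : Form Agent} (h : Prov (A.imp B))
    (hA : f A ∈ w) : f B ∈ w :=
  (hw.isVal.imp _ _).1 (hw.mp (hf.K A B) (hw.ofProv (hf.nec _ h))) hA

theorem refl (hf : S5op f) (hw : MaxConsistent w) : opRel f w w := fun A h => hw.mp (hf.T A) h

theorem eucl (hf : S5op f) (hw : MaxConsistent w) (hw1 : MaxConsistent w1)
    (h1 : opRel f w w1) (h2 : opRel f w w2) : opRel f w1 w2 := by
  intro A hA
  by_contra hn
  have h3 : f A ∉ w := fun h => hn (h2 A h)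
  have h4 : f A.neg.neg ∉ w := fun h =>
    h3 (hf.mono hw (prov0 fun v hv => by simp [hv.imp, hv.neg]) h)
  have h5 := h1 _ (hw.mp (hf.five A.neg) ((hw.mem_neg _).2 h4))
  exact (hw1.mem_neg _).1 h5 (hf.mono hw1 (prov0 fun v hv => by simp [hv.imp, hv.neg]) hA)

theorem symm (hf : S5op f) (hw : MaxConsistent w) (hw1 : MaxConsistent w1)
    (h1 : opRel f w w1) : opRel f w1 w := hf.eucl hw hw1 h1 (hf.refl hw)

theorem trans (hf : S5op f) (hw : MaxConsistent w) (hw1 : MaxConsistent w1)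
    (h1 : opRel f w w1) (h2 : opRel f w1 w2) : opRel f w w2 :=
  hf.eucl hw1 hw (hf.symm hw hw1 h1) h2

theorem lc (hf : S5op f) (hw : MaxConsistent w) (l : List (Form Agent)) (h : ∀ B ∈ l, f B ∈ w) :
    f (listConj l) ∈ w := by
  induction l with
  | nil => exact hw.ofProv (hf.nec _ (prov0 fun v hv => by simp [hv.lc]))
  | cons A l ih =>
    have h1 := ih fun B hB => h B (by simp [hB])
    have h2 := h A (by simp)
    have h3 : f ((listConj l).imp (listConj (A :: l))) ∈ w :=
      hf.mono hw (prov0 fun v hv => by simp [hv.imp, hv.conj, listConj]; tauto) h2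
    exact (hw.isVal.imp _ _).1 (hw.mp (hf.K _ _) h3) h1

theorem exists_of (hf : S5op f) (hw : MaxConsistent w) {A : Form Agent} (h : f A ∉ w) :
    ∃ w', MaxConsistent w' ∧ opRel f w w' ∧ A ∉ w' := by
  have hc : Consistent (insert A.neg {B | f B ∈ w}) := by
    by_contra hc
    obtain ⟨l, hl, hp⟩ := incons_insert hc
    refine h (hf.mono hw (prov1 hp fun v hv h => ?_) (hf.lc hw l hl))
    rwa [hv.imp, hv.neg, hv.neg, not_not, ← hv.imp] at h
  obtain ⟨w', hw', hs⟩ := lindenbaum hc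
  exact ⟨w', hw', fun B hB => hs (Set.mem_insert_of_mem _ hB),
    (hw'.mem_neg _).1 (hs (Set.mem_insert _ _))⟩

end S5op

theorem xi_mem {X : Set (Set (Form Agent))} (hX : X ∈ Xi Agent) {w : Set (Form Agent)}
    (h : w ∈ X) : MaxConsistent w ∧ X = RCls w := by
  obtain ⟨u, hu, rfl⟩ := hX
  obtain ⟨hw, hr⟩ := h
  refine ⟨hw, Set.ext fun w' => ⟨fun h => ⟨h.1, ?_⟩, fun h => ⟨h.1, ?_⟩⟩⟩
  · exact s5_box.eucl hu hw hr h.2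
  · exact s5_box.trans hu hw hr h.2

theorem rcls_xi {w : Set (Form Agent)} (hw : MaxConsistent w) : RCls w ∈ Xi Agent ∧ w ∈ RCls w :=
  ⟨⟨w, hw, rfl⟩, hw, s5_box.refl hw⟩

theorem xi_nonempty {X : Set (Set (Form Agent))} (hX : X ∈ Xi Agent) : ∃ w, w ∈ X := by
  obtain ⟨u, hu, rfl⟩ := hX
  exact ⟨u, (rcls_xi hu).2⟩

def wPt {w : Set (Form Agent)} (hw : MaxConsistent w) : CTree Agent :=
  ⟨some (Sum.inr w), Or.inr (Or.inr ⟨w, hw, rfl⟩)⟩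

theorem cw_comp {w : Set (Form Agent)} (hw : MaxConsistent w) {x y : CTree Agent}
    (hx : x.1 = some (Sum.inr w)) (h : CLe x y ∨ CLe y x) : y ∈ CHistX (RCls w) w := by
  have key : CLe x y ∨ CLe y x → y.1 = none ∨ y.1 = some (Sum.inr w) ∨
      ∃ X, y.1 = some (Sum.inl X) ∧ w ∈ X := by
    rintro ((rfl | ⟨X, u, h1, h2, h3⟩ | h1) | (rfl | ⟨X, u, h1, h2, h3⟩ | h1))
    · exact Or.inr (Or.inl hx)
    · rw [hx] at h1; cases h1
    · rw [hx] at h1; cases h1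
    · exact Or.inr (Or.inl hx)
    · rw [hx] at h2; cases h2; exact Or.inr (Or.inr ⟨X, h1, h3⟩)
    · exact Or.inl h1
  rcases key h with h | h | ⟨X, h, h'⟩
  · exact Or.inl h
  · exact Or.inr (Or.inr h)
  · rcases y.2 with e | ⟨Y, hY, e⟩ | ⟨u, hu, e⟩
    · rw [h] at e; cases e
    · have e' := h.symm.trans e
      cases e'
      exact Or.inr (Or.inl (by rw [h, (xi_mem hY h').2]))
    · rw [h] at e; cases e

theorem chist_chain {X : Set (Set (Form Agent))} {w : Set (Form Agent)} (hw : w ∈ X) :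
    IsChain CLe (CHistX X w) := by
  intro x hx y hy hne
  rcases hx with hx | hx | hx
  · exact Or.inl (Or.inr (Or.inr hx))
  · rcases hy with hy | hy | hy
    · exact Or.inr (Or.inr (Or.inr hy))
    · exact absurd (Subtype.ext (hx.trans hy.symm)) hne
    · exact Or.inl (Or.inr (Or.inl ⟨X, w, hx, hy, hw⟩))
  · rcases hy with hy | hy | hy
    · exact Or.inr (Or.inr (Or.inr hy))
    · exact Or.inr (Or.inr (Or.inl ⟨X, w, hy, hx, hw⟩))
    · exact absurd (Subtype.ext (hx.trans hy.symm)) hne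

theorem chain_comp {h : Set (CTree Agent)} (hh : IsChain CLe h) {x y : CTree Agent} (hx : x ∈ h)
    (hy : y ∈ h) : CLe x y ∨ CLe y x := by
  by_cases e : x = y
  · exact Or.inl (Or.inl e)
  · exact hh hx hy e

theorem hist_iff (h : Set (CTree Agent)) :
    IsMaxChain CLe h ↔ ∃ X w, X ∈ Xi Agent ∧ w ∈ X ∧ h = CHistX X w := by
  constructor
  · intro hh
    suffices ∃ X w, X ∈ Xi Agent ∧ w ∈ X ∧ h ⊆ CHistX X w by
      obtain ⟨X, w, hX, hw, hs⟩ := this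
      exact ⟨X, w, hX, hw, hh.2 (chist_chain hw) hs⟩
    by_cases h1 : ∃ x ∈ h, ∃ w, MaxConsistent w ∧ x.1 = some (Sum.inr w)
    · obtain ⟨x, hx, w, hw, e⟩ := h1
      exact ⟨RCls w, w, (rcls_xi hw).1, (rcls_xi hw).2,
        fun y hy => cw_comp hw e (chain_comp hh.1 hx hy)⟩
    · by_cases h2 : ∃ x ∈ h, ∃ X ∈ Xi Agent, x.1 = some (Sum.inl X)
      · obtain ⟨x, hx, X, hX, e⟩ := h2
        obtain ⟨w, hw⟩ := xi_nonempty hX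
        refine ⟨X, w, hX, hw, fun y hy => ?_⟩
        rcases y.2 with e' | ⟨Y, hY, e'⟩ | ⟨u, hu, e'⟩
        · exact Or.inl e'
        · refine Or.inr (Or.inl ?_)
          rcases chain_comp hh.1 hx hy with
            (rfl | ⟨_, _, _, h2, _⟩ | h1) | (rfl | ⟨_, _, _, h2, _⟩ | h1)
          · exact e
          · rw [e'] at h2; cases h2
          · rw [e] at h1; cases h1
          · exact e
          · rw [e] at h2; cases h2
          · rw [e'] at h1; cases h1
        · exact absurd ⟨y, hy, u, hu, e'⟩ h1
      · refine ⟨_, _, (rcls_xi cw_max).1, (rcls_xi cw_max).2, fun y hy => ?_⟩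
        rcases y.2 with e' | ⟨Y, hY, e'⟩ | ⟨u, hu, e'⟩
        · exact Or.inl e'
        · exact absurd ⟨y, hy, Y, hY, e'⟩ h2
        · exact absurd ⟨y, hy, u, hu, e'⟩ h1
  · rintro ⟨X, w, hX, hw, rfl⟩
    refine ⟨chist_chain hw, fun t ht hs => Set.Subset.antisymm hs fun y hy => ?_⟩
    obtain ⟨hm, e⟩ := xi_mem hX hw
    rw [e]
    exact cw_comp hm (x := wPt hm) rfl
      (chain_comp ht (hs (Or.inr (Or.inr rfl))) hy)

theorem hist_inj {X Y : Set (Set (Form Agent))} {w u : Set (Form Agent)} (hw : MaxConsistent w)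
    (h : CHistX X w = CHistX Y u) : w = u := by
  have h1 : wPt hw ∈ CHistX Y u := h ▸ Or.inr (Or.inr rfl)
  rcases h1 with h1 | h1 | h1
  · cases h1
  · cases h1
  · cases h1; rfl

/-- histories through a class moment -/
theorem hm_cls {m : CTree Agent} {X : Set (Set (Form Agent))} (hm : m.1 = some (Sum.inl X))
    (h : Set (CTree Agent)) : h ∈ (CanModel Agent).Hm m ↔ ∃ w ∈ X, h = CHistX X w := by
  have hX : X ∈ Xi Agent := by
    rcases m.2 with e | ⟨Y, hY, e⟩ | ⟨u, hu, e⟩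
    · rw [hm] at e; cases e
    · have e' := hm.symm.trans e
      cases e'; exact hY
    · rw [hm] at e; cases e
  constructor
  · rintro ⟨h1, h2⟩
    obtain ⟨Y, w, hY, hw, rfl⟩ := (hist_iff h).1 h1
    rcases h2 with e | e | e
    · rw [hm] at e; cases e
    · have e' := hm.symm.trans e
      cases e'; exact ⟨w, hw, rfl⟩
    · rw [hm] at e; cases e
  · rintro ⟨w, hw, rfl⟩
    exact ⟨(hist_iff _).2 ⟨X, w, hX, hw, rfl⟩, Or.inr (Or.inl hm)⟩

theorem cell_cls {m : CTree Agent} {X : Set (Set (Form Agent))} (hX : X ∈ Xi Agent)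
    (hm : m.1 = some (Sum.inl X))
    (a : Agent) {w : Set (Form Agent)} (hw : w ∈ X)
    (h : Set (CTree Agent)) : h ∈ (CanModel Agent).Cell m a (CHistX X w) ↔
      ∃ u ∈ X, CanC a w u ∧ h = CHistX X u := by
  have hwm := (xi_mem hX hw).1
  constructor
  · rintro ⟨H, hH, h1, h2⟩
    rcases hH with ⟨hn, _⟩ | ⟨Y, hY, e, ⟨t, ht, rfl⟩, rfl⟩
    · exact absurd ⟨X, hm⟩ hn
    · have e' := hm.symm.trans hY
      cases e'
      obtain ⟨w', ⟨hw', hc'⟩, e1⟩ := h1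
      obtain ⟨u, ⟨hu, hc⟩, rfl⟩ := h2
      have := hist_inj hwm e1
      subst this
      exact ⟨u, hu, (s5_c a).eucl (xi_mem hX ht).1 hwm hc' hc, rfl⟩
  · rintro ⟨u, hu, hc, rfl⟩
    exact ⟨_, Or.inr ⟨X, hm, _, ⟨w, hw, rfl⟩, rfl⟩, ⟨w, ⟨hw, (s5_c a).refl hwm⟩, rfl⟩,
      ⟨u, ⟨hu, hc⟩, rfl⟩⟩

theorem cell_ncls {m : CTree Agent} (hm : ¬ IsClsMoment m)
    (a : Agent) {h0 : Set (CTree Agent)} (hh : h0 ∈ (CanModel Agent).Hm m)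
    (h : Set (CTree Agent)) : h ∈ (CanModel Agent).Cell m a h0 ↔ h ∈ (CanModel Agent).Hm m := by
  constructor
  · rintro ⟨H, hH, h1, h2⟩
    rcases hH with ⟨_, rfl⟩ | ⟨Y, hY, _⟩
    · exact h2
    · exact absurd ⟨Y, hY⟩ hm
  · intro h2
    exact ⟨_, Or.inl ⟨hm, rfl⟩, hh, h2⟩

theorem truth_ncls (B : Form Agent) : ∀ (m : CTree Agent), ¬ IsClsMoment m →
    ∀ h, h ∈ (CanModel Agent).Hm m → ((CanModel Agent).Sat B m h ↔ cv B) := by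
  induction B with
  | var n =>
    intro m hm h hh
    simp only [cv, iff_false]
    rintro ⟨X, w, _, _, _, h1, _⟩
    exact hm ⟨X, h1⟩
  | fls => intro m hm h hh; exact Iff.rfl
  | imp A B ihA ihB =>
    intro m hm h hh
    simp only [PreModel.Sat, cv, ihA m hm h hh, ihB m hm h hh]
  | box A ih =>
    intro m hm h hh
    exact ⟨fun H => (ih m hm h hh).1 (H h hh), fun H h' hh' => (ih m hm h' hh').2 H⟩
  | cstit a A ih =>
    intro m hm h hh
    exact ⟨fun H => (ih m hm h hh).1 (H h ((cell_ncls hm a hh h).2 hh)),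
      fun H h' hh' => (ih m hm h' ((cell_ncls hm a hh h').1 hh')).2 H⟩
  | imag a A ih =>
    intro m hm h hh
    simp only [cv, iff_false]
    rintro ⟨H, _⟩
    obtain ⟨X, w, h1, _⟩ := H h ((cell_ncls hm a hh h).2 hh)
    exact hm ⟨X, h1⟩

theorem ext_of (B : Form Agent)
    (H : ∀ (m : CTree Agent) X w, X ∈ Xi Agent → w ∈ X → m.1 = some (Sum.inl X) →
      ((CanModel Agent).Sat B m (CHistX X w) ↔ B ∈ w)) :
    CExt B = {p : CTree Agent × Set (CTree Agent) |
      (CanModel Agent).IsHist p.2 ∧ p.1 ∈ p.2 ∧ (CanModel Agent).Sat B p.1 p.2} := by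
  ext ⟨m, h⟩
  constructor
  · rintro (⟨X, w, hX, hw, hB, hm, he⟩ | ⟨⟨w0, hw0, hs, hB⟩, X, w, hX, hw, he, hm, hmem⟩)
    · change m.1 = _ at hm
      change h = _ at he
      subst he
      exact ⟨(hist_iff _).2 ⟨X, w, hX, hw, rfl⟩, Or.inr (Or.inl hm), (H m X w hX hw hm).2 hB⟩
    · have hh : IsMaxChain CLe h := (hist_iff _).2 ⟨X, w, hX, hw, he⟩
      exact ⟨hh, hmem, (truth_ncls B m hm h ⟨hh, hmem⟩).2 ((eq_cw hw0 hs B).1 hB)⟩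
  · rintro ⟨hh, hmem, hB⟩
    by_cases hm : IsClsMoment m
    · obtain ⟨X, hX⟩ := hm
      obtain ⟨w, hw, he⟩ := (hm_cls hX h).1 ⟨hh, hmem⟩
      change h = _ at he
      subst he
      have hXi : X ∈ Xi Agent := by
        rcases m.2 with e | ⟨Y, hY, e⟩ | ⟨u, hu, e⟩
        · rw [hX] at e; cases e
        · have e' := hX.symm.trans e
          cases e'; exact hY
        · rw [hX] at e; cases e
      exact Or.inl ⟨X, w, hXi, hw, (H m X w hXi hw hX).1 hB, hX, rfl⟩
    · obtain ⟨X, w, hX, hw, he⟩ := (hist_iff h).1 hh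
      exact Or.inr ⟨⟨cw Agent, cw_max, cw_sigma, (truth_ncls B m hm h ⟨hh, hmem⟩).1 hB⟩,
        X, w, hX, hw, he, hm, hmem⟩

theorem cext_mem {X : Set (Set (Form Agent))} (hX : X ∈ Xi Agent) {w : Set (Form Agent)}
    (hw : w ∈ X) (A : Form Agent) : (clsMoment hX, CHistX X w) ∈ CExt A ↔ A ∈ w := by
  constructor
  · rintro (⟨Y, u, hY, hu, hA, h1, h2⟩ | ⟨_, _, _, _, _, _, h, _⟩)
    · rw [hist_inj (xi_mem hX hw).1 h2]; exact hA
    · exact absurd ⟨X, rfl⟩ h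
  · intro h
    exact Or.inl ⟨X, w, hX, hw, h, rfl, rfl⟩

theorem cext_imag {A C : Form Agent} (h : CExt A = CExt C) (a : Agent) {w : Set (Form Agent)}
    (hw : MaxConsistent w) (hC : Form.imag a C ∈ w) : Form.imag a A ∈ w := by
  have hp : Prov (A.fiff C) := prov_of_all fun u hu => (hu.isVal.fiff _ _).2 (by
    rw [← cext_mem (rcls_xi hu).1 (rcls_xi hu).2 A, h, cext_mem (rcls_xi hu).1 (rcls_xi hu).2 C])
  exact ((hw.isVal.fiff _ _).1 (hw.ofProv (Prov.reI a hp))).2 hC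

theorem cn_iff {m : CTree Agent} {X : Set (Set (Form Agent))} (hX : X ∈ Xi Agent)
    (hm : m.1 = some (Sum.inl X)) (a : Agent) {w : Set (Form Agent)} (hw : w ∈ X)
    (A : Form Agent) : CExt A ∈ CN a m (CHistX X w) ↔ Form.imag a A ∈ w := by
  constructor
  · rintro ⟨Y, u, h1, hY, hu, he, C, hC, hE⟩
    rw [← hist_inj (xi_mem hX hw).1 he] at hC
    exact cext_imag hE a (xi_mem hX hw).1 hC
  · intro h
    exact ⟨X, w, hm, hX, hw, rfl, A, h, rfl⟩

theorem truth_cls (B : Form Agent) : ∀ (m : CTree Agent) X w, X ∈ Xi Agent → w ∈ X →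
    m.1 = some (Sum.inl X) → ((CanModel Agent).Sat B m (CHistX X w) ↔ B ∈ w) := by
  induction B with
  | var n =>
    intro m X w hX hw hm
    constructor
    · rintro ⟨Y, u, hY, hu, hA, h1, h2⟩
      rw [hist_inj (xi_mem hX hw).1 h2]; exact hA
    · intro h
      exact ⟨X, w, hX, hw, h, hm, rfl⟩
  | fls =>
    intro m X w hX hw hm
    simpa [PreModel.Sat] using (xi_mem hX hw).1.fls_not
  | imp A B ihA ihB =>
    intro m X w hX hw hm
    rw [show (A.imp B ∈ w ↔ _) from (xi_mem hX hw).1.isVal.imp A B, ← ihA m X w hX hw hm,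
      ← ihB m X w hX hw hm]
    rfl
  | box A ih =>
    intro m X w hX hw hm
    obtain ⟨hwm, e⟩ := xi_mem hX hw
    constructor
    · intro H
      by_contra hn
      obtain ⟨u, hu, hr, hA⟩ := s5_box.exists_of hwm hn
      have huX : u ∈ X := by rw [e]; exact ⟨hu, hr⟩
      exact hA ((ih m X u hX huX hm).1 (H _ ((hm_cls hm _).2 ⟨u, huX, rfl⟩)))
    · intro H h' hh'
      obtain ⟨u, hu, rfl⟩ := (hm_cls hm h').1 hh'
      refine (ih m X u hX hu hm).2 ?_
      rw [e] at hu
      exact hu.2 A H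
  | cstit a A ih =>
    intro m X w hX hw hm
    obtain ⟨hwm, e⟩ := xi_mem hX hw
    constructor
    · intro H
      by_contra hn
      obtain ⟨u, hu, hr, hA⟩ := (s5_c a).exists_of hwm hn
      have huX : u ∈ X := by rw [e]; exact ⟨hu, fun C hC => hr C (hwm.mp (Prov.a3 a C) hC)⟩
      exact hA ((ih m X u hX huX hm).1 (H _ ((cell_cls hX hm a hw _).2 ⟨u, huX, hr, rfl⟩)))
    · intro H h' hh'
      obtain ⟨u, hu, hc, rfl⟩ := (cell_cls hX hm a hw h').1 hh'
      exact (ih m X u hX hu hm).2 (hc A H)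
  | imag a A ih =>
    intro m X w hX hw hm
    obtain ⟨hwm, e⟩ := xi_mem hX hw
    have hE := ext_of A ih
    have hS : (CanModel Agent).Sat (.imag a A) m (CHistX X w) ↔
        ((∀ h' ∈ (CanModel Agent).Cell m a (CHistX X w), CExt A ∈ CN a m h') ∧
         ∃ h'' ∈ (CanModel Agent).Hm m, CExt A ∉ CN a m h'') := by
      rw [hE]; rfl
    rw [hS]
    constructor
    · rintro ⟨H, _⟩
      exact (cn_iff hX hm a hw A).1
        (H _ ((cell_cls hX hm a hw _).2 ⟨w, hw, (s5_c a).refl hwm, rfl⟩))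
    · intro H
      obtain ⟨h1, h2⟩ := (hwm.isVal.conj _ _).1 (hwm.mp (Prov.a5 a A) H)
      constructor
      · intro h' hh'
        obtain ⟨u, hu, hc, rfl⟩ := (cell_cls hX hm a hw h').1 hh'
        exact (cn_iff hX hm a hu A).2 (hc _ h1)
      · obtain ⟨u, hu, hr, hA⟩ := s5_box.exists_of hwm ((hwm.mem_neg _).1 h2)
        have huX : u ∈ X := by rw [e]; exact ⟨hu, hr⟩
        exact ⟨_, (hm_cls hm _).2 ⟨u, huX, rfl⟩, fun h => hA ((cn_iff hX hm a huX A).1 h)⟩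

end Helpers

/-- extensions coincide with truth sets in the canonical model:
    Ext(B) = {m/h : m/h a moment-history pair of M with M, m/h ⊨ B}. -/
theorem ext_eq_truth_set (Agent : Type) [Fintype Agent] (B : Form Agent) :
    CExt B = {p : CTree Agent × Set (CTree Agent) |
      (CanModel Agent).IsHist p.2 ∧ p.1 ∈ p.2 ∧ (CanModel Agent).Sat B p.1 p.2} := by
  exact ext_of B (truth_cls B)
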